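/- arXiv:1106.5636 — 9 statements merged into one kernel-verified Lean document; each statement's English description precedes it below -/
import Mathlib

section
/- Let G be a group with elements γ₁,…,γ₈ and γ₁',…,γ₈' satisfying relations (1)–(5) below. Then the following braid relations hold: for every a ∈ {γ₂,γ₂'} and b ∈ {γ₃,γ₃'}: aba = bab; for every b ∈ {γ₃,γ₃'} and c ∈ {γ₅,γ₅'}: bcb = cbc; and for every a ∈ {γ₂,γ₂'} and c ∈ {γ₅,γ₅'}: aca = cac. (Proposition 3.3, relation (6).) -/
/-- For braided pairs of elements, if the product of the second pair conjugates the first pair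
into each other, then the same holds with the two pairs exchanged. -/
theorem mul_mul_eq_of_braid {G : Type*} [Group G] {a a' b b' : G}
    (h₁ : a * b' * a = b' * a * b') (h₂ : a' * b * a' = b * a' * b)
    (h : b' = a⁻¹ * a'⁻¹ * b * a' * a) : b' * b * a' = a * (b' * b) := by
  have e₁ : a * b' * a⁻¹ = b'⁻¹ * a * b' := by
    rw [mul_inv_eq_iff_eq_mul, mul_assoc, mul_assoc, eq_inv_mul_iff_mul_eq, ← mul_assoc,
      ← mul_assoc, ← h₁, mul_assoc]
  have e₂ : a'⁻¹ * b * a' = b * a' * b⁻¹ := by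
    rw [eq_mul_inv_iff_mul_eq, mul_assoc, mul_assoc, inv_mul_eq_iff_eq_mul, ← mul_assoc,
      ← mul_assoc, ← h₂, mul_assoc]
  have e₃ : b'⁻¹ * a * b' = b * a' * b⁻¹ := by
    rw [← e₁, ← e₂, h]
    group
  calc b' * b * a' = b' * (b * a' * b⁻¹) * b := by group
    _ = a * (b' * b) := by
      rw [← e₃]
      group

/-- The braid relation with `x` transfers along conjugation by an element commuting with `x`. -/
theorem braid_iff_of_conj {G : Type*} [Group G] {c x y z : G}
    (hx : c * x = x * c) (hy : c * y = z * c) :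
    x * y * x = y * x * y ↔ x * z * x = z * x * z := by
  have e₁ : c * (x * y * x) = x * z * x * c := by
    rw [← mul_assoc, ← mul_assoc, hx, mul_assoc x, hy, mul_assoc, mul_assoc, hx]
    simp only [mul_assoc]
  have e₂ : c * (y * x * y) = z * x * z * c := by
    rw [← mul_assoc, ← mul_assoc, hy, mul_assoc z, hx, mul_assoc, mul_assoc, hy]
    simp only [mul_assoc]
  rw [← mul_left_cancel_iff (a := c), e₁, e₂, mul_left_inj]

/-- In a triple of elements with `x, y` and `y, z` braided, if `y * x * y⁻¹` commutes with `z` then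
`x, z` are braided. -/
theorem braid_of_conj_commute {G : Type*} [Group G] {x y z : G}
    (hxy : x * y * x = y * x * y) (hyz : y * z * y = z * y * z)
    (h : y * x * y⁻¹ * z = z * (y * x * y⁻¹)) : x * z * x = z * x * z := by
  have hw : y * x * y⁻¹ * y = x * (y * x * y⁻¹) := by
    rw [inv_mul_cancel_right, ← mul_assoc, eq_mul_inv_iff_mul_eq, ← mul_assoc, hxy]
  exact ((braid_iff_of_conj h hw).1 hyz.symm).symm

theorem stmt0 {G : Type*} [Group G]
    (g1 g2 g3 g4 g5 g6 g7 g8 g1' g2' g3' g4' g5' g6' g7' g8' : G)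
    (h1 : g1 = g1')
    (h2_67 : ∀ a ∈ ({g6, g6'} : Set G), ∀ b ∈ ({g7, g7'} : Set G), a * b * a = b * a * b)
    (h2_48 : ∀ a ∈ ({g4, g4'} : Set G), ∀ b ∈ ({g8, g8'} : Set G), a * b * a = b * a * b)
    (h2_12 : ∀ a ∈ ({g1, g1'} : Set G), ∀ b ∈ ({g2, g2'} : Set G), a * b * a = b * a * b)
    (h2_34 : ∀ a ∈ ({g3, g3'} : Set G), ∀ b ∈ ({g4, g4'} : Set G), a * b * a = b * a * b)
    (h2_56 : ∀ a ∈ ({g5, g5'} : Set G), ∀ b ∈ ({g6, g6'} : Set G), a * b * a = b * a * b)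
    (h2_78 : ∀ a ∈ ({g7, g7'} : Set G), ∀ b ∈ ({g8, g8'} : Set G), a * b * a = b * a * b)
    (h3_a : g7' = g6⁻¹ * g6'⁻¹ * g7 * g6' * g6)
    (h3_b : g4 = g8' * g8 * g4' * g8⁻¹ * g8'⁻¹)
    (h3_c : g1 = g2' * g2 * g1' * g2⁻¹ * g2'⁻¹)
    (h3_d : g4' = g3⁻¹ * g3'⁻¹ * g4 * g3' * g3)
    (h3_e : g5 = g6' * g6 * g5' * g6⁻¹ * g6'⁻¹)
    (h3_f : g7 = g8' * g8 * g7' * g8⁻¹ * g8'⁻¹)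
    (h4_13 : ∀ a ∈ ({g1, g1'} : Set G), ∀ b ∈ ({g3, g3'} : Set G), a * b = b * a)
    (h4_24 : ∀ a ∈ ({g2, g2'} : Set G), ∀ b ∈ ({g4, g4'} : Set G), a * b = b * a)
    (h4_14 : ∀ a ∈ ({g1, g1'} : Set G), ∀ b ∈ ({g4, g4'} : Set G), a * b = b * a)
    (h4_15 : ∀ a ∈ ({g1, g1'} : Set G), ∀ b ∈ ({g5, g5'} : Set G), a * b = b * a)
    (h4_45 : ∀ a ∈ ({g4, g4'} : Set G), ∀ b ∈ ({g5, g5'} : Set G), a * b = b * a)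
    (h4_16 : ∀ a ∈ ({g1, g1'} : Set G), ∀ b ∈ ({g6, g6'} : Set G), a * b = b * a)
    (h4_26 : ∀ a ∈ ({g2, g2'} : Set G), ∀ b ∈ ({g6, g6'} : Set G), a * b = b * a)
    (h4_36 : ∀ a ∈ ({g3, g3'} : Set G), ∀ b ∈ ({g6, g6'} : Set G), a * b = b * a)
    (h4_46 : ∀ a ∈ ({g4, g4'} : Set G), ∀ b ∈ ({g6, g6'} : Set G), a * b = b * a)
    (h4_17 : ∀ a ∈ ({g1, g1'} : Set G), ∀ b ∈ ({g7, g7'} : Set G), a * b = b * a)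
    (h4_27 : ∀ a ∈ ({g2, g2'} : Set G), ∀ b ∈ ({g7, g7'} : Set G), a * b = b * a)
    (h4_37 : ∀ a ∈ ({g3, g3'} : Set G), ∀ b ∈ ({g7, g7'} : Set G), a * b = b * a)
    (h4_47 : ∀ a ∈ ({g4, g4'} : Set G), ∀ b ∈ ({g7, g7'} : Set G), a * b = b * a)
    (h4_57 : ∀ a ∈ ({g5, g5'} : Set G), ∀ b ∈ ({g7, g7'} : Set G), a * b = b * a)
    (h4_18 : ∀ a ∈ ({g1, g1'} : Set G), ∀ b ∈ ({g8, g8'} : Set G), a * b = b * a)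
    (h4_28 : ∀ a ∈ ({g2, g2'} : Set G), ∀ b ∈ ({g8, g8'} : Set G), a * b = b * a)
    (h4_38 : ∀ a ∈ ({g3, g3'} : Set G), ∀ b ∈ ({g8, g8'} : Set G), a * b = b * a)
    (h4_58 : ∀ a ∈ ({g5, g5'} : Set G), ∀ b ∈ ({g8, g8'} : Set G), a * b = b * a)
    (h4_68 : ∀ a ∈ ({g6, g6'} : Set G), ∀ b ∈ ({g8, g8'} : Set G), a * b = b * a)
    (h5_a : ∀ a ∈ ({g2, g2'} : Set G), a * g3 * a = g3 * a * g3)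
    (h5_b : ∀ b ∈ ({g5, g5'} : Set G), b * g3' * b = g3' * b * g3')
    (h5_c : g5' * g5 * g3' * g5⁻¹ * g5'⁻¹ = g3 * g2' * g2 * g3 * g2⁻¹ * g2'⁻¹ * g3⁻¹)
    (h5_d : ∀ a ∈ ({g2, g2'} : Set G), ∀ b ∈ ({g5, g5'} : Set G),
      (g3 * a * g3⁻¹) * b = b * (g3 * a * g3⁻¹)) :
    (∀ a ∈ ({g2, g2'} : Set G), ∀ b ∈ ({g3, g3'} : Set G), a * b * a = b * a * b) ∧
    (∀ b ∈ ({g3, g3'} : Set G), ∀ c ∈ ({g5, g5'} : Set G), b * c * b = c * b * c) ∧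
    (∀ a ∈ ({g2, g2'} : Set G), ∀ c ∈ ({g5, g5'} : Set G), a * c * a = c * a * c) := by
  have key : g4' * g4 * g3' = g3 * (g4' * g4) :=
    mul_mul_eq_of_braid (h2_34 g3 (by simp) g4' (by simp)) (h2_34 g3' (by simp) g4 (by simp)) h3_d
  have comm₂ : ∀ a ∈ ({g2, g2'} : Set G), g4' * g4 * a = a * (g4' * g4) := fun a ha => by
    rw [mul_assoc, ← h4_24 a ha g4 (by simp), ← mul_assoc, ← h4_24 a ha g4' (by simp), mul_assoc]
  have comm₅ : ∀ c ∈ ({g5, g5'} : Set G), g4' * g4 * c = c * (g4' * g4) := fun c hc => by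
    rw [mul_assoc, h4_45 g4 (by simp) c hc, ← mul_assoc, h4_45 g4' (by simp) c hc, mul_assoc]
  have braid₂₃ : ∀ a ∈ ({g2, g2'} : Set G), a * g3' * a = g3' * a * g3' := fun a ha =>
    (braid_iff_of_conj (comm₂ a ha) key).2 (h5_a a ha)
  have braid₅₃ : ∀ c ∈ ({g5, g5'} : Set G), c * g3 * c = g3 * c * g3 := fun c hc =>
    (braid_iff_of_conj (comm₅ c hc) key).1 (h5_b c hc)
  refine ⟨?_, ?_, fun a ha c hc =>
    braid_of_conj_commute (h5_a a ha) (braid₅₃ c hc).symm (h5_d a ha c hc)⟩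
  · rintro a ha b (rfl | rfl)
    exacts [h5_a a ha, braid₂₃ a ha]
  · rintro b (rfl | rfl) c hc
    exacts [(braid₅₃ c hc).symm, (h5_b c hc).symm]
end

section
/- Let G be a group with elements γ₁,…,γ₈ and γ₁',…,γ₈' satisfying relations (1)–(5) below. Then for every a ∈ {γ₂,γ₂'}, b ∈ {γ₃,γ₃'}, c ∈ {γ₅,γ₅'} the commutation relation [a⁻¹ba, c] = e holds, i.e. (a⁻¹ba)c = c(a⁻¹ba). (Proposition 3.3, relation (7).) -/
theorem conj_eq_inv_conj_of_braid {G : Type*} [Group G] {x y : G}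
    (h : x * y * x = y * x * y) : x * y * x⁻¹ = y⁻¹ * x * y := by
  rw [mul_inv_eq_iff_eq_mul, mul_assoc, mul_assoc, eq_inv_mul_iff_mul_eq, ← mul_assoc, ← mul_assoc]
  exact h.symm

theorem stmt1 {G : Type*} [Group G]
    (g1 g2 g3 g4 g5 g6 g7 g8 g1' g2' g3' g4' g5' g6' g7' g8' : G)
    (h1 : g1 = g1')
    (h2_67 : ∀ a ∈ ({g6, g6'} : Set G), ∀ b ∈ ({g7, g7'} : Set G), a * b * a = b * a * b)
    (h2_48 : ∀ a ∈ ({g4, g4'} : Set G), ∀ b ∈ ({g8, g8'} : Set G), a * b * a = b * a * b)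
    (h2_12 : ∀ a ∈ ({g1, g1'} : Set G), ∀ b ∈ ({g2, g2'} : Set G), a * b * a = b * a * b)
    (h2_34 : ∀ a ∈ ({g3, g3'} : Set G), ∀ b ∈ ({g4, g4'} : Set G), a * b * a = b * a * b)
    (h2_56 : ∀ a ∈ ({g5, g5'} : Set G), ∀ b ∈ ({g6, g6'} : Set G), a * b * a = b * a * b)
    (h2_78 : ∀ a ∈ ({g7, g7'} : Set G), ∀ b ∈ ({g8, g8'} : Set G), a * b * a = b * a * b)
    (h3_a : g7' = g6⁻¹ * g6'⁻¹ * g7 * g6' * g6)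
    (h3_b : g4 = g8' * g8 * g4' * g8⁻¹ * g8'⁻¹)
    (h3_c : g1 = g2' * g2 * g1' * g2⁻¹ * g2'⁻¹)
    (h3_d : g4' = g3⁻¹ * g3'⁻¹ * g4 * g3' * g3)
    (h3_e : g5 = g6' * g6 * g5' * g6⁻¹ * g6'⁻¹)
    (h3_f : g7 = g8' * g8 * g7' * g8⁻¹ * g8'⁻¹)
    (h4_13 : ∀ a ∈ ({g1, g1'} : Set G), ∀ b ∈ ({g3, g3'} : Set G), a * b = b * a)
    (h4_24 : ∀ a ∈ ({g2, g2'} : Set G), ∀ b ∈ ({g4, g4'} : Set G), a * b = b * a)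
    (h4_14 : ∀ a ∈ ({g1, g1'} : Set G), ∀ b ∈ ({g4, g4'} : Set G), a * b = b * a)
    (h4_15 : ∀ a ∈ ({g1, g1'} : Set G), ∀ b ∈ ({g5, g5'} : Set G), a * b = b * a)
    (h4_45 : ∀ a ∈ ({g4, g4'} : Set G), ∀ b ∈ ({g5, g5'} : Set G), a * b = b * a)
    (h4_16 : ∀ a ∈ ({g1, g1'} : Set G), ∀ b ∈ ({g6, g6'} : Set G), a * b = b * a)
    (h4_26 : ∀ a ∈ ({g2, g2'} : Set G), ∀ b ∈ ({g6, g6'} : Set G), a * b = b * a)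
    (h4_36 : ∀ a ∈ ({g3, g3'} : Set G), ∀ b ∈ ({g6, g6'} : Set G), a * b = b * a)
    (h4_46 : ∀ a ∈ ({g4, g4'} : Set G), ∀ b ∈ ({g6, g6'} : Set G), a * b = b * a)
    (h4_17 : ∀ a ∈ ({g1, g1'} : Set G), ∀ b ∈ ({g7, g7'} : Set G), a * b = b * a)
    (h4_27 : ∀ a ∈ ({g2, g2'} : Set G), ∀ b ∈ ({g7, g7'} : Set G), a * b = b * a)
    (h4_37 : ∀ a ∈ ({g3, g3'} : Set G), ∀ b ∈ ({g7, g7'} : Set G), a * b = b * a)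
    (h4_47 : ∀ a ∈ ({g4, g4'} : Set G), ∀ b ∈ ({g7, g7'} : Set G), a * b = b * a)
    (h4_57 : ∀ a ∈ ({g5, g5'} : Set G), ∀ b ∈ ({g7, g7'} : Set G), a * b = b * a)
    (h4_18 : ∀ a ∈ ({g1, g1'} : Set G), ∀ b ∈ ({g8, g8'} : Set G), a * b = b * a)
    (h4_28 : ∀ a ∈ ({g2, g2'} : Set G), ∀ b ∈ ({g8, g8'} : Set G), a * b = b * a)
    (h4_38 : ∀ a ∈ ({g3, g3'} : Set G), ∀ b ∈ ({g8, g8'} : Set G), a * b = b * a)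
    (h4_58 : ∀ a ∈ ({g5, g5'} : Set G), ∀ b ∈ ({g8, g8'} : Set G), a * b = b * a)
    (h4_68 : ∀ a ∈ ({g6, g6'} : Set G), ∀ b ∈ ({g8, g8'} : Set G), a * b = b * a)
    (h5_a : ∀ a ∈ ({g2, g2'} : Set G), a * g3 * a = g3 * a * g3)
    (h5_b : ∀ b ∈ ({g5, g5'} : Set G), b * g3' * b = g3' * b * g3')
    (h5_c : g5' * g5 * g3' * g5⁻¹ * g5'⁻¹ = g3 * g2' * g2 * g3 * g2⁻¹ * g2'⁻¹ * g3⁻¹)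
    (h5_d : ∀ a ∈ ({g2, g2'} : Set G), ∀ b ∈ ({g5, g5'} : Set G),
      (g3 * a * g3⁻¹) * b = b * (g3 * a * g3⁻¹)) :
    ∀ a ∈ ({g2, g2'} : Set G), ∀ b ∈ ({g3, g3'} : Set G), ∀ c ∈ ({g5, g5'} : Set G),
      (a⁻¹ * b * a) * c = c * (a⁻¹ * b * a) := by
  have hg3' : g3' = g4⁻¹ * g4'⁻¹ * g3 * g4' * g4 := by
    have e₁ := conj_eq_inv_conj_of_braid (h2_34 g3 (by simp) g4' (by simp))
    have e₂ := conj_eq_inv_conj_of_braid (h2_34 g3' (by simp) g4 (by simp)).symm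
    have e₃ : g3 * g4' * g3⁻¹ = g3'⁻¹ * g4 * g3' := by rw [h3_d]; group
    have e₄ : g4 * g3' * g4⁻¹ = g4'⁻¹ * g3 * g4' := by rw [e₂, ← e₃, e₁]
    calc g3' = g4⁻¹ * (g4 * g3' * g4⁻¹) * g4 := by group
      _ = g4⁻¹ * g4'⁻¹ * g3 * g4' * g4 := by rw [e₄]; group
  intro a ha b hb c hc
  have hbase : Commute (a⁻¹ * g3 * a) c := by
    rw [← conj_eq_inv_conj_of_braid (h5_a a ha).symm]
    exact h5_d a ha c hc
  rcases hb with rfl | rfl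
  · exact hbase
  · have ha4 : Commute a (g4' * g4) :=
      Commute.mul_right (h4_24 a ha g4' (by simp)) (h4_24 a ha g4 (by simp))
    have hc4 : Commute (g4' * g4) c :=
      Commute.mul_left (h4_45 g4' (by simp) c hc) (h4_45 g4 (by simp) c hc)
    have hconj : a⁻¹ * b * a = (g4' * g4)⁻¹ * (a⁻¹ * g3 * a) * (g4' * g4) := by
      calc a⁻¹ * b * a = (a⁻¹ * (g4' * g4)⁻¹) * g3 * ((g4' * g4) * a) := by rw [hg3']; group
        _ = ((g4' * g4)⁻¹ * a⁻¹) * g3 * (a * (g4' * g4)) := by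
          rw [ha4.inv_inv.eq, ha4.eq]
        _ = (g4' * g4)⁻¹ * (a⁻¹ * g3 * a) * (g4' * g4) := by group
    rw [hconj]
    exact ((hc4.inv_left.mul_left hbase).mul_left hc4).eq
end

section
/- Let G be a group with elements γ₁,…,γ₈ and γ₁',…,γ₈' satisfying relations (1)–(5) below. Then the following identities hold: γ₁' = γ₁, γ₂' = γ₁⁻¹γ₂γ₁γ₂⁻¹γ₁, γ₃' = γ₄⁻¹γ₃γ₄'γ₃⁻¹γ₄, γ₈' = γ₄⁻¹γ₈γ₄'γ₈⁻¹γ₄, γ₇' = γ₈⁻¹γ₈'⁻¹γ₇γ₈'γ₈, γ₆' = γ₇⁻¹γ₆γ₇'γ₆⁻¹γ₇, γ₅' = γ₆⁻¹γ₆'⁻¹γ₅γ₆'γ₆. Consequently, each of γ₁',…,γ₈' lies in the subgroup of G generated by γ₁,…,γ₈ and γ₄', so the subgroup generated by all the γᵢ and γᵢ' is generated by γ₁,…,γ₈,γ₄'. (Relations (8) of Section 3.2.) -/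
/-- If `x` and `y'` satisfy the braid relation and `x = y' y x' y⁻¹ y'⁻¹`, then `y'` can be
expressed through `x`, `x'` and `y`. -/
theorem eq_conj_of_braid_of_conj {G : Type*} [Group G] {x x' y y' : G}
    (hb : x * y' * x = y' * x * y') (hc : x = y' * y * x' * y⁻¹ * y'⁻¹) :
    y' = x⁻¹ * y * x' * y⁻¹ * x := by
  have hx' : y * x' * y⁻¹ = y'⁻¹ * x * y' := by
    rw [hc]
    group
  calc
    y' = x⁻¹ * y'⁻¹ * (y' * x * y') := by group
    _ = x⁻¹ * (y'⁻¹ * x * y') * x := by rw [← hb]; group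
    _ = x⁻¹ * y * x' * y⁻¹ * x := by rw [← hx']; group

theorem stmt2 {G : Type*} [Group G]
    (g1 g2 g3 g4 g5 g6 g7 g8 g1' g2' g3' g4' g5' g6' g7' g8' : G)
    (h1 : g1 = g1')
    (h2_67 : ∀ a ∈ ({g6, g6'} : Set G), ∀ b ∈ ({g7, g7'} : Set G), a * b * a = b * a * b)
    (h2_48 : ∀ a ∈ ({g4, g4'} : Set G), ∀ b ∈ ({g8, g8'} : Set G), a * b * a = b * a * b)
    (h2_12 : ∀ a ∈ ({g1, g1'} : Set G), ∀ b ∈ ({g2, g2'} : Set G), a * b * a = b * a * b)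
    (h2_34 : ∀ a ∈ ({g3, g3'} : Set G), ∀ b ∈ ({g4, g4'} : Set G), a * b * a = b * a * b)
    (h2_56 : ∀ a ∈ ({g5, g5'} : Set G), ∀ b ∈ ({g6, g6'} : Set G), a * b * a = b * a * b)
    (h2_78 : ∀ a ∈ ({g7, g7'} : Set G), ∀ b ∈ ({g8, g8'} : Set G), a * b * a = b * a * b)
    (h3_a : g7' = g6⁻¹ * g6'⁻¹ * g7 * g6' * g6)
    (h3_b : g4 = g8' * g8 * g4' * g8⁻¹ * g8'⁻¹)
    (h3_c : g1 = g2' * g2 * g1' * g2⁻¹ * g2'⁻¹)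
    (h3_d : g4' = g3⁻¹ * g3'⁻¹ * g4 * g3' * g3)
    (h3_e : g5 = g6' * g6 * g5' * g6⁻¹ * g6'⁻¹)
    (h3_f : g7 = g8' * g8 * g7' * g8⁻¹ * g8'⁻¹)
    (h4_13 : ∀ a ∈ ({g1, g1'} : Set G), ∀ b ∈ ({g3, g3'} : Set G), a * b = b * a)
    (h4_24 : ∀ a ∈ ({g2, g2'} : Set G), ∀ b ∈ ({g4, g4'} : Set G), a * b = b * a)
    (h4_14 : ∀ a ∈ ({g1, g1'} : Set G), ∀ b ∈ ({g4, g4'} : Set G), a * b = b * a)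
    (h4_15 : ∀ a ∈ ({g1, g1'} : Set G), ∀ b ∈ ({g5, g5'} : Set G), a * b = b * a)
    (h4_45 : ∀ a ∈ ({g4, g4'} : Set G), ∀ b ∈ ({g5, g5'} : Set G), a * b = b * a)
    (h4_16 : ∀ a ∈ ({g1, g1'} : Set G), ∀ b ∈ ({g6, g6'} : Set G), a * b = b * a)
    (h4_26 : ∀ a ∈ ({g2, g2'} : Set G), ∀ b ∈ ({g6, g6'} : Set G), a * b = b * a)
    (h4_36 : ∀ a ∈ ({g3, g3'} : Set G), ∀ b ∈ ({g6, g6'} : Set G), a * b = b * a)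
    (h4_46 : ∀ a ∈ ({g4, g4'} : Set G), ∀ b ∈ ({g6, g6'} : Set G), a * b = b * a)
    (h4_17 : ∀ a ∈ ({g1, g1'} : Set G), ∀ b ∈ ({g7, g7'} : Set G), a * b = b * a)
    (h4_27 : ∀ a ∈ ({g2, g2'} : Set G), ∀ b ∈ ({g7, g7'} : Set G), a * b = b * a)
    (h4_37 : ∀ a ∈ ({g3, g3'} : Set G), ∀ b ∈ ({g7, g7'} : Set G), a * b = b * a)
    (h4_47 : ∀ a ∈ ({g4, g4'} : Set G), ∀ b ∈ ({g7, g7'} : Set G), a * b = b * a)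
    (h4_57 : ∀ a ∈ ({g5, g5'} : Set G), ∀ b ∈ ({g7, g7'} : Set G), a * b = b * a)
    (h4_18 : ∀ a ∈ ({g1, g1'} : Set G), ∀ b ∈ ({g8, g8'} : Set G), a * b = b * a)
    (h4_28 : ∀ a ∈ ({g2, g2'} : Set G), ∀ b ∈ ({g8, g8'} : Set G), a * b = b * a)
    (h4_38 : ∀ a ∈ ({g3, g3'} : Set G), ∀ b ∈ ({g8, g8'} : Set G), a * b = b * a)
    (h4_58 : ∀ a ∈ ({g5, g5'} : Set G), ∀ b ∈ ({g8, g8'} : Set G), a * b = b * a)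
    (h4_68 : ∀ a ∈ ({g6, g6'} : Set G), ∀ b ∈ ({g8, g8'} : Set G), a * b = b * a)
    (h5_a : ∀ a ∈ ({g2, g2'} : Set G), a * g3 * a = g3 * a * g3)
    (h5_b : ∀ b ∈ ({g5, g5'} : Set G), b * g3' * b = g3' * b * g3')
    (h5_c : g5' * g5 * g3' * g5⁻¹ * g5'⁻¹ = g3 * g2' * g2 * g3 * g2⁻¹ * g2'⁻¹ * g3⁻¹)
    (h5_d : ∀ a ∈ ({g2, g2'} : Set G), ∀ b ∈ ({g5, g5'} : Set G),
      (g3 * a * g3⁻¹) * b = b * (g3 * a * g3⁻¹)) :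
    g1' = g1 ∧
    g2' = g1⁻¹ * g2 * g1 * g2⁻¹ * g1 ∧
    g3' = g4⁻¹ * g3 * g4' * g3⁻¹ * g4 ∧
    g8' = g4⁻¹ * g8 * g4' * g8⁻¹ * g4 ∧
    g7' = g8⁻¹ * g8'⁻¹ * g7 * g8' * g8 ∧
    g6' = g7⁻¹ * g6 * g7' * g6⁻¹ * g7 ∧
    g5' = g6⁻¹ * g6'⁻¹ * g5 * g6' * g6 ∧
    (∀ x ∈ ({g1', g2', g3', g4', g5', g6', g7', g8'} : Set G),
      x ∈ Subgroup.closure ({g1, g2, g3, g4, g5, g6, g7, g8, g4'} : Set G)) ∧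
    Subgroup.closure
        ({g1, g2, g3, g4, g5, g6, g7, g8, g1', g2', g3', g4', g5', g6', g7', g8'} : Set G) =
      Subgroup.closure ({g1, g2, g3, g4, g5, g6, g7, g8, g4'} : Set G) := by
  have e2 : g2' = g1⁻¹ * g2 * g1 * g2⁻¹ * g1 := by
    rw [← h1] at h3_c
    exact eq_conj_of_braid_of_conj (h2_12 g1 (by simp) g2' (by simp)) h3_c
  have e3 : g3' = g4⁻¹ * g3 * g4' * g3⁻¹ * g4 :=
    eq_conj_of_braid_of_conj (h2_34 g3' (by simp) g4 (by simp)).symm (by rw [h3_d]; group)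
  have e8 : g8' = g4⁻¹ * g8 * g4' * g8⁻¹ * g4 :=
    eq_conj_of_braid_of_conj (h2_48 g4 (by simp) g8' (by simp)) h3_b
  have e7 : g7' = g8⁻¹ * g8'⁻¹ * g7 * g8' * g8 := by
    rw [h3_f]; group
  have e6 : g6' = g7⁻¹ * g6 * g7' * g6⁻¹ * g7 :=
    eq_conj_of_braid_of_conj (h2_67 g6' (by simp) g7 (by simp)).symm (by rw [h3_a]; group)
  have e5 : g5' = g6⁻¹ * g6'⁻¹ * g5 * g6' * g6 := by
    rw [h3_e]; group
  have hgen : ∀ x ∈ ({g1, g2, g3, g4, g5, g6, g7, g8, g4'} : Set G),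
      x ∈ Subgroup.closure ({g1, g2, g3, g4, g5, g6, g7, g8, g4'} : Set G) :=
    fun _ hx => Subgroup.subset_closure hx
  have hmem : ∀ x ∈ ({g1', g2', g3', g4', g5', g6', g7', g8'} : Set G),
      x ∈ Subgroup.closure ({g1, g2, g3, g4, g5, g6, g7, g8, g4'} : Set G) := by
    generalize Subgroup.closure ({g1, g2, g3, g4, g5, g6, g7, g8, g4'} : Set G) = H at hgen ⊢
    simp only [Set.mem_insert_iff, Set.mem_singleton_iff, forall_eq_or_imp, forall_eq] at hgen ⊢
    obtain ⟨m1, m2, m3, m4, m5, m6, m7, m8, m4'⟩ := hgen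
    have conj_mem {a b c : G} (ha : a ∈ H) (hb : b ∈ H) (hc : c ∈ H) :
        a⁻¹ * b * c * b⁻¹ * a ∈ H :=
      mul_mem (mul_mem (mul_mem (mul_mem (inv_mem ha) hb) hc) (inv_mem hb)) ha
    have conj_mem' {a b c : G} (ha : a ∈ H) (hb : b ∈ H) (hc : c ∈ H) :
        a⁻¹ * b⁻¹ * c * b * a ∈ H := by
      simpa using conj_mem ha (inv_mem hb) hc
    have m8' : g8' ∈ H := e8 ▸ conj_mem m4 m8 m4'
    have m7' : g7' ∈ H := e7 ▸ conj_mem' m8 m8' m7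
    have m6' : g6' ∈ H := e6 ▸ conj_mem m7 m6 m7'
    have m5' : g5' ∈ H := e5 ▸ conj_mem' m6 m6' m5
    exact ⟨h1 ▸ m1, e2 ▸ conj_mem m1 m2 m1, e3 ▸ conj_mem m4 m3 m4', m4', m5', m6', m7', m8'⟩
  refine ⟨h1.symm, e2, e3, e8, e7, e6, e5, hmem, le_antisymm ?_ ?_⟩
  · rw [Subgroup.closure_le]
    intro x hx
    simp only [Set.mem_insert_iff, Set.mem_singleton_iff] at hx hgen hmem
    by_cases hx' : x = g1' ∨ x = g2' ∨ x = g3' ∨ x = g4' ∨ x = g5' ∨ x = g6' ∨ x = g7' ∨ x = g8'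
    · exact hmem x hx'
    · exact hgen x (by tauto)
  · apply Subgroup.closure_mono
    intro x hx
    simp only [Set.mem_insert_iff, Set.mem_singleton_iff] at hx ⊢
    tauto
end

section
/- Let G be a group with elements γ₁,…,γ₈ and γ₁',…,γ₈' satisfying relations (1)–(5) below, and write a_b := b⁻¹ab. Then the relation ρ₁ holds: (γ₄')_{γ₃⁻¹γ₄γ₅⁻¹γ₆⁻¹γ₇⁻¹γ₈⁻¹γ₄⁻¹γ₈γ₄'⁻¹γ₈⁻¹γ₄γ₇⁻¹γ₆⁻¹γ₅⁻¹} = (γ₃)_{γ₂⁻¹γ₁⁻¹γ₂γ₁⁻¹γ₂⁻¹γ₁γ₃⁻¹}. (Relation (9) of Section 3.2, obtained by substituting the expressions (8) for the primed generators into the second relation of (5).) -/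
section

variable {G : Type*} [Group G] {a a' b b' : G}

/-- A braid relation says that conjugating `a` by `b⁻¹` or `b` by `a` gives the same element. -/
theorem inv_mul_mul_eq_of_braid (h : a * b * a = b * a * b) : b⁻¹ * a * b = a * b * a⁻¹ := by
  rw [eq_mul_inv_iff_mul_eq, mul_assoc b⁻¹, mul_assoc, inv_mul_eq_iff_eq_mul, h, mul_assoc]

/-- If `a` is the conjugate of `a'` by `b' * b`, and `a`, `b'` satisfy the braid relation, then
`a'` is a word in `a`, `b`, `b'`. -/
theorem eq_conj_of_braid_left (h : a * b' * a = b' * a * b')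
    (hc : a = b' * b * a' * b⁻¹ * b'⁻¹) : a' = b⁻¹ * a * b' * a⁻¹ * b := by
  have ha' : a' = b⁻¹ * (b'⁻¹ * a * b') * b := by
    rw [hc]
    group
  rw [ha', inv_mul_mul_eq_of_braid h]
  group

/-- If `b` is the conjugate of `b'` by `a' * a`, and `b`, `a'` satisfy the braid relation, then
`a'` is a word in `a`, `b`, `b'`. -/
theorem eq_conj_of_braid_right (h : b * a' * b = a' * b * a')
    (hc : b = a' * a * b' * a⁻¹ * a'⁻¹) : a' = b⁻¹ * a * b' * a⁻¹ * b := by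
  have hb : b * a' * b⁻¹ = a * b' * a⁻¹ := by
    rw [← inv_mul_mul_eq_of_braid h]
    nth_rw 1 [hc]
    group
  calc a' = b⁻¹ * (b * a' * b⁻¹) * b := by group
    _ = b⁻¹ * a * b' * a⁻¹ * b := by
      rw [hb]
      group

theorem mul_eq_of_eq_conj (h : a * b * a = b * a * b) (ha' : a' = b⁻¹ * a * b' * a⁻¹ * b) :
    a' * a = b⁻¹ * a * (b' * b) * a * b⁻¹ := by
  have hba : a⁻¹ * b * a = b * a * b⁻¹ := inv_mul_mul_eq_of_braid h.symm
  calc a' * a = b⁻¹ * a * b' * (a⁻¹ * b * a) := by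
        rw [ha']
        group
    _ = b⁻¹ * a * (b' * b) * a * b⁻¹ := by
        rw [hba]
        group

/-- Along a chain `a`, `b`, `c`, `d` whose neighbours braid, the product `a' * a` is obtained
from `d' * d` by conjugations. -/
theorem mul_eq_of_chain {c c' d d' : G} (hab : a * b * a = b * a * b) (hbc : b * c * b = c * b * c)
    (hcd : c * d * c = d * c * d) (hac : Commute a c) (had : Commute a d) (hbd : Commute b d)
    (ha' : a' = b⁻¹ * a * b' * a⁻¹ * b) (hb' : b' = c⁻¹ * b * c' * b⁻¹ * c)
    (hc' : c' = d⁻¹ * c * d' * c⁻¹ * d) :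
    a * b * c * d' * d * c * b * a = (d * c * b) * (a' * a) * (b * c * d) := by
  rw [mul_eq_of_eq_conj hab ha', mul_eq_of_eq_conj hbc hb', mul_eq_of_eq_conj hcd hc']
  have e₁ : d * c * b * b⁻¹ * a * c⁻¹ * b * d⁻¹ = a * b := by
    rw [mul_inv_cancel_right, mul_assoc d, ← hac.eq, ← mul_assoc, mul_inv_cancel_right,
      ← had.eq, mul_assoc a, ← hbd.eq, ← mul_assoc, mul_inv_cancel_right]
  have e₂ : d⁻¹ * b * c⁻¹ * a * b⁻¹ * b * c * d = b * a := by
    rw [inv_mul_cancel_right, mul_assoc _ a, hac.eq, ← mul_assoc, inv_mul_cancel_right,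
      mul_assoc _ a, had.eq, ← mul_assoc, mul_assoc d⁻¹, hbd.eq, inv_mul_cancel_left]
  calc a * b * c * d' * d * c * b * a = a * b * (c * d' * d * c) * (b * a) := by group
    _ = (d * c * b * b⁻¹ * a * c⁻¹ * b * d⁻¹) * (c * d' * d * c) *
        (d⁻¹ * b * c⁻¹ * a * b⁻¹ * b * c * d) := by rw [e₁, e₂]
    _ = _ := by group

end

theorem stmt3 {G : Type*} [Group G]
    (g1 g2 g3 g4 g5 g6 g7 g8 g1' g2' g3' g4' g5' g6' g7' g8' : G)
    (h1 : g1 = g1')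
    (h2_67 : ∀ a ∈ ({g6, g6'} : Set G), ∀ b ∈ ({g7, g7'} : Set G), a * b * a = b * a * b)
    (h2_48 : ∀ a ∈ ({g4, g4'} : Set G), ∀ b ∈ ({g8, g8'} : Set G), a * b * a = b * a * b)
    (h2_12 : ∀ a ∈ ({g1, g1'} : Set G), ∀ b ∈ ({g2, g2'} : Set G), a * b * a = b * a * b)
    (h2_34 : ∀ a ∈ ({g3, g3'} : Set G), ∀ b ∈ ({g4, g4'} : Set G), a * b * a = b * a * b)
    (h2_56 : ∀ a ∈ ({g5, g5'} : Set G), ∀ b ∈ ({g6, g6'} : Set G), a * b * a = b * a * b)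
    (h2_78 : ∀ a ∈ ({g7, g7'} : Set G), ∀ b ∈ ({g8, g8'} : Set G), a * b * a = b * a * b)
    (h3_a : g7' = g6⁻¹ * g6'⁻¹ * g7 * g6' * g6)
    (h3_b : g4 = g8' * g8 * g4' * g8⁻¹ * g8'⁻¹)
    (h3_c : g1 = g2' * g2 * g1' * g2⁻¹ * g2'⁻¹)
    (h3_d : g4' = g3⁻¹ * g3'⁻¹ * g4 * g3' * g3)
    (h3_e : g5 = g6' * g6 * g5' * g6⁻¹ * g6'⁻¹)
    (h3_f : g7 = g8' * g8 * g7' * g8⁻¹ * g8'⁻¹)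
    (h4_13 : ∀ a ∈ ({g1, g1'} : Set G), ∀ b ∈ ({g3, g3'} : Set G), a * b = b * a)
    (h4_24 : ∀ a ∈ ({g2, g2'} : Set G), ∀ b ∈ ({g4, g4'} : Set G), a * b = b * a)
    (h4_14 : ∀ a ∈ ({g1, g1'} : Set G), ∀ b ∈ ({g4, g4'} : Set G), a * b = b * a)
    (h4_15 : ∀ a ∈ ({g1, g1'} : Set G), ∀ b ∈ ({g5, g5'} : Set G), a * b = b * a)
    (h4_45 : ∀ a ∈ ({g4, g4'} : Set G), ∀ b ∈ ({g5, g5'} : Set G), a * b = b * a)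
    (h4_16 : ∀ a ∈ ({g1, g1'} : Set G), ∀ b ∈ ({g6, g6'} : Set G), a * b = b * a)
    (h4_26 : ∀ a ∈ ({g2, g2'} : Set G), ∀ b ∈ ({g6, g6'} : Set G), a * b = b * a)
    (h4_36 : ∀ a ∈ ({g3, g3'} : Set G), ∀ b ∈ ({g6, g6'} : Set G), a * b = b * a)
    (h4_46 : ∀ a ∈ ({g4, g4'} : Set G), ∀ b ∈ ({g6, g6'} : Set G), a * b = b * a)
    (h4_17 : ∀ a ∈ ({g1, g1'} : Set G), ∀ b ∈ ({g7, g7'} : Set G), a * b = b * a)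
    (h4_27 : ∀ a ∈ ({g2, g2'} : Set G), ∀ b ∈ ({g7, g7'} : Set G), a * b = b * a)
    (h4_37 : ∀ a ∈ ({g3, g3'} : Set G), ∀ b ∈ ({g7, g7'} : Set G), a * b = b * a)
    (h4_47 : ∀ a ∈ ({g4, g4'} : Set G), ∀ b ∈ ({g7, g7'} : Set G), a * b = b * a)
    (h4_57 : ∀ a ∈ ({g5, g5'} : Set G), ∀ b ∈ ({g7, g7'} : Set G), a * b = b * a)
    (h4_18 : ∀ a ∈ ({g1, g1'} : Set G), ∀ b ∈ ({g8, g8'} : Set G), a * b = b * a)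
    (h4_28 : ∀ a ∈ ({g2, g2'} : Set G), ∀ b ∈ ({g8, g8'} : Set G), a * b = b * a)
    (h4_38 : ∀ a ∈ ({g3, g3'} : Set G), ∀ b ∈ ({g8, g8'} : Set G), a * b = b * a)
    (h4_58 : ∀ a ∈ ({g5, g5'} : Set G), ∀ b ∈ ({g8, g8'} : Set G), a * b = b * a)
    (h4_68 : ∀ a ∈ ({g6, g6'} : Set G), ∀ b ∈ ({g8, g8'} : Set G), a * b = b * a)
    (h5_a : ∀ a ∈ ({g2, g2'} : Set G), a * g3 * a = g3 * a * g3)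
    (h5_b : ∀ b ∈ ({g5, g5'} : Set G), b * g3' * b = g3' * b * g3')
    (h5_c : g5' * g5 * g3' * g5⁻¹ * g5'⁻¹ = g3 * g2' * g2 * g3 * g2⁻¹ * g2'⁻¹ * g3⁻¹)
    (h5_d : ∀ a ∈ ({g2, g2'} : Set G), ∀ b ∈ ({g5, g5'} : Set G),
      (g3 * a * g3⁻¹) * b = b * (g3 * a * g3⁻¹)) :
    (g3⁻¹ * g4 * g5⁻¹ * g6⁻¹ * g7⁻¹ * g8⁻¹ * g4⁻¹ * g8 * g4'⁻¹ * g8⁻¹ * g4 * g7⁻¹ * g6⁻¹ * g5⁻¹)⁻¹ * g4' * (g3⁻¹ * g4 * g5⁻¹ * g6⁻¹ * g7⁻¹ * g8⁻¹ * g4⁻¹ * g8 * g4'⁻¹ * g8⁻¹ * g4 * g7⁻¹ * g6⁻¹ * g5⁻¹) =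
      (g2⁻¹ * g1⁻¹ * g2 * g1⁻¹ * g2⁻¹ * g1 * g3⁻¹)⁻¹ * g3 * (g2⁻¹ * g1⁻¹ * g2 * g1⁻¹ * g2⁻¹ * g1 * g3⁻¹) := by
  subst h1
  have l {x y : G} : x ∈ ({x, y} : Set G) := Or.inl rfl
  have r {x y : G} : y ∈ ({x, y} : Set G) := Or.inr rfl
  have e2 : g2' = g1⁻¹ * g2 * g1 * g2⁻¹ * g1 := eq_conj_of_braid_right (h2_12 _ l _ r) h3_c
  have e3 : g3' = g4⁻¹ * g3 * g4' * g3⁻¹ * g4 :=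
    eq_conj_of_braid_right (h2_34 _ r _ l).symm (by rw [h3_d]; group)
  have e5 : g5' = g6⁻¹ * g5 * g6' * g5⁻¹ * g6 := eq_conj_of_braid_left (h2_56 _ l _ r) h3_e
  have e6 : g6' = g7⁻¹ * g6 * g7' * g6⁻¹ * g7 :=
    eq_conj_of_braid_right (h2_67 _ r _ l).symm (by rw [h3_a]; group)
  have e7 : g7' = g8⁻¹ * g7 * g8' * g7⁻¹ * g8 := eq_conj_of_braid_left (h2_78 _ l _ r) h3_f
  have e8 : g8' = g4⁻¹ * g8 * g4' * g8⁻¹ * g4 := eq_conj_of_braid_right (h2_48 _ l _ r) h3_b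
  have hchain := mul_eq_of_chain (h2_56 _ l _ l) (h2_67 _ l _ l) (h2_78 _ l _ l)
    (h4_57 _ l _ l) (h4_58 _ l _ l) (h4_68 _ l _ l) e5 e6 e7
  have c2 : Commute (g8 * g7 * g6) g2 :=
    ((show Commute g2 g8 from h4_28 _ l _ l).mul_right (h4_27 _ l _ l)
      |>.mul_right (h4_26 _ l _ l)).symm
  have c2' : Commute (g8 * g7 * g6) g2' :=
    ((show Commute g2' g8 from h4_28 _ r _ l).mul_right (h4_27 _ r _ l)
      |>.mul_right (h4_26 _ r _ l)).symm
  have c3 : Commute (g8 * g7 * g6) g3 :=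
    ((show Commute g3 g8 from h4_38 _ l _ l).mul_right (h4_37 _ l _ l)
      |>.mul_right (h4_36 _ l _ l)).symm
  have c3' : Commute (g6 * g7 * g8) g3' :=
    ((show Commute g3' g6 from h4_36 _ r _ l).mul_right (h4_37 _ r _ l)
      |>.mul_right (h4_38 _ r _ l)).symm
  have cw : Commute (g8 * g7 * g6) (g3 * g2' * g2 * g3 * g2⁻¹ * g2'⁻¹ * g3⁻¹) :=
    (((((c3.mul_right c2').mul_right c2).mul_right c3).mul_right c2.inv_right).mul_right
      c2'.inv_right).mul_right c3.inv_right
  have e22 : g1⁻¹ * g2 * g1 * g2⁻¹ * g1 * g2 = g2' * g2 := by rw [e2]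
  calc _ = (g5 * g6 * g7 * (g4⁻¹ * g8 * g4' * g8⁻¹ * g4) * g8 * g7 * g6 * g5) *
          (g4⁻¹ * g3 * g4' * g3⁻¹ * g4) *
          (g5 * g6 * g7 * (g4⁻¹ * g8 * g4' * g8⁻¹ * g4) * g8 * g7 * g6 * g5)⁻¹ := by group
    _ = (g8 * g7 * g6) * (g5' * g5) * ((g6 * g7 * g8) * g3' * (g6 * g7 * g8)⁻¹) *
          (g5' * g5)⁻¹ * (g8 * g7 * g6)⁻¹ := by
        rw [← e8, ← e3, hchain]
        group
    _ = (g8 * g7 * g6) * (g5' * g5 * g3' * g5⁻¹ * g5'⁻¹) * (g8 * g7 * g6)⁻¹ := by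
        rw [c3'.eq, mul_inv_cancel_right]
        group
    _ = g3 * (g2' * g2) * g3 * (g2' * g2)⁻¹ * g3⁻¹ := by
        rw [h5_c, cw.eq, mul_inv_cancel_right]
        group
    _ = _ := by
        rw [← e22]
        group
end

section
/- Let G be a group with elements γ₁,…,γ₈ and γ₁',…,γ₈' satisfying relations (1)–(5) below. Then the braid relations ⟨γ₈γ₄'γ₈⁻¹, γ₄⟩ = e and ⟨γ₃γ₄'γ₃⁻¹, γ₄⟩ = e hold, i.e. (γ₈γ₄'γ₈⁻¹)γ₄(γ₈γ₄'γ₈⁻¹) = γ₄(γ₈γ₄'γ₈⁻¹)γ₄ and (γ₃γ₄'γ₃⁻¹)γ₄(γ₃γ₄'γ₃⁻¹) = γ₄(γ₃γ₄'γ₃⁻¹)γ₄. (Proposition 3.6, relation (10).) -/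
/-- If `a` and `x` satisfy the braid relation and `y` is the conjugate `a⁻¹ * x * a`, then
`y` and `x` satisfy the braid relation. -/
theorem braid_conj_of_braid {G : Type*} [Group G] {a x y : G}
    (hax : a * x * a = x * a * x) (hx : x = a * y * a⁻¹) : y * x * y = x * y * x := by
  have hy : y = x * a * x⁻¹ := by
    have hy' : y = a⁻¹ * x * a := by
      rw [hx]
      group
    rw [hy', eq_mul_inv_iff_mul_eq, mul_assoc a⁻¹, mul_assoc a⁻¹, inv_mul_eq_iff_eq_mul,
      ← mul_assoc, hax.symm]
  calc y * x * y = x * (a * x * a) * x⁻¹ := by rw [hy]; group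
    _ = x * y * x := by rw [hax, hy]; group

theorem stmt4 {G : Type*} [Group G]
    (g1 g2 g3 g4 g5 g6 g7 g8 g1' g2' g3' g4' g5' g6' g7' g8' : G)
    (h1 : g1 = g1')
    (h2_67 : ∀ a ∈ ({g6, g6'} : Set G), ∀ b ∈ ({g7, g7'} : Set G), a * b * a = b * a * b)
    (h2_48 : ∀ a ∈ ({g4, g4'} : Set G), ∀ b ∈ ({g8, g8'} : Set G), a * b * a = b * a * b)
    (h2_12 : ∀ a ∈ ({g1, g1'} : Set G), ∀ b ∈ ({g2, g2'} : Set G), a * b * a = b * a * b)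
    (h2_34 : ∀ a ∈ ({g3, g3'} : Set G), ∀ b ∈ ({g4, g4'} : Set G), a * b * a = b * a * b)
    (h2_56 : ∀ a ∈ ({g5, g5'} : Set G), ∀ b ∈ ({g6, g6'} : Set G), a * b * a = b * a * b)
    (h2_78 : ∀ a ∈ ({g7, g7'} : Set G), ∀ b ∈ ({g8, g8'} : Set G), a * b * a = b * a * b)
    (h3_a : g7' = g6⁻¹ * g6'⁻¹ * g7 * g6' * g6)
    (h3_b : g4 = g8' * g8 * g4' * g8⁻¹ * g8'⁻¹)
    (h3_c : g1 = g2' * g2 * g1' * g2⁻¹ * g2'⁻¹)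
    (h3_d : g4' = g3⁻¹ * g3'⁻¹ * g4 * g3' * g3)
    (h3_e : g5 = g6' * g6 * g5' * g6⁻¹ * g6'⁻¹)
    (h3_f : g7 = g8' * g8 * g7' * g8⁻¹ * g8'⁻¹)
    (h4_13 : ∀ a ∈ ({g1, g1'} : Set G), ∀ b ∈ ({g3, g3'} : Set G), a * b = b * a)
    (h4_24 : ∀ a ∈ ({g2, g2'} : Set G), ∀ b ∈ ({g4, g4'} : Set G), a * b = b * a)
    (h4_14 : ∀ a ∈ ({g1, g1'} : Set G), ∀ b ∈ ({g4, g4'} : Set G), a * b = b * a)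
    (h4_15 : ∀ a ∈ ({g1, g1'} : Set G), ∀ b ∈ ({g5, g5'} : Set G), a * b = b * a)
    (h4_45 : ∀ a ∈ ({g4, g4'} : Set G), ∀ b ∈ ({g5, g5'} : Set G), a * b = b * a)
    (h4_16 : ∀ a ∈ ({g1, g1'} : Set G), ∀ b ∈ ({g6, g6'} : Set G), a * b = b * a)
    (h4_26 : ∀ a ∈ ({g2, g2'} : Set G), ∀ b ∈ ({g6, g6'} : Set G), a * b = b * a)
    (h4_36 : ∀ a ∈ ({g3, g3'} : Set G), ∀ b ∈ ({g6, g6'} : Set G), a * b = b * a)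
    (h4_46 : ∀ a ∈ ({g4, g4'} : Set G), ∀ b ∈ ({g6, g6'} : Set G), a * b = b * a)
    (h4_17 : ∀ a ∈ ({g1, g1'} : Set G), ∀ b ∈ ({g7, g7'} : Set G), a * b = b * a)
    (h4_27 : ∀ a ∈ ({g2, g2'} : Set G), ∀ b ∈ ({g7, g7'} : Set G), a * b = b * a)
    (h4_37 : ∀ a ∈ ({g3, g3'} : Set G), ∀ b ∈ ({g7, g7'} : Set G), a * b = b * a)
    (h4_47 : ∀ a ∈ ({g4, g4'} : Set G), ∀ b ∈ ({g7, g7'} : Set G), a * b = b * a)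
    (h4_57 : ∀ a ∈ ({g5, g5'} : Set G), ∀ b ∈ ({g7, g7'} : Set G), a * b = b * a)
    (h4_18 : ∀ a ∈ ({g1, g1'} : Set G), ∀ b ∈ ({g8, g8'} : Set G), a * b = b * a)
    (h4_28 : ∀ a ∈ ({g2, g2'} : Set G), ∀ b ∈ ({g8, g8'} : Set G), a * b = b * a)
    (h4_38 : ∀ a ∈ ({g3, g3'} : Set G), ∀ b ∈ ({g8, g8'} : Set G), a * b = b * a)
    (h4_58 : ∀ a ∈ ({g5, g5'} : Set G), ∀ b ∈ ({g8, g8'} : Set G), a * b = b * a)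
    (h4_68 : ∀ a ∈ ({g6, g6'} : Set G), ∀ b ∈ ({g8, g8'} : Set G), a * b = b * a)
    (h5_a : ∀ a ∈ ({g2, g2'} : Set G), a * g3 * a = g3 * a * g3)
    (h5_b : ∀ b ∈ ({g5, g5'} : Set G), b * g3' * b = g3' * b * g3')
    (h5_c : g5' * g5 * g3' * g5⁻¹ * g5'⁻¹ = g3 * g2' * g2 * g3 * g2⁻¹ * g2'⁻¹ * g3⁻¹)
    (h5_d : ∀ a ∈ ({g2, g2'} : Set G), ∀ b ∈ ({g5, g5'} : Set G),
      (g3 * a * g3⁻¹) * b = b * (g3 * a * g3⁻¹)) :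
    ((g8 * g4' * g8⁻¹) * g4 * (g8 * g4' * g8⁻¹) = g4 * (g8 * g4' * g8⁻¹) * g4) ∧
    ((g3 * g4' * g3⁻¹) * g4 * (g3 * g4' * g3⁻¹) = g4 * (g3 * g4' * g3⁻¹) * g4) := by
  constructor
  · refine braid_conj_of_braid (a := g8') (h2_48 g4 (by simp) g8' (by simp)).symm ?_
    simpa only [mul_assoc] using h3_b
  · refine braid_conj_of_braid (a := g3') (h2_34 g3' (by simp) g4 (by simp)) ?_
    rw [h3_d]
    group
end

section
/- Let G be a group with elements γ₁,…,γ₈ and γ₁',…,γ₈' satisfying relations (1)–(5) below. Then the braid relation ⟨γ₃⁻¹γ₄γ₃, γ₅γ₆γ₇γ₈γ₄'γ₈⁻¹γ₇⁻¹γ₆⁻¹γ₅⁻¹⟩ = e holds; that is, writing u = γ₃⁻¹γ₄γ₃ and v = γ₅γ₆γ₇γ₈γ₄'γ₈⁻¹γ₇⁻¹γ₆⁻¹γ₅⁻¹, one has uvu = vuv. (Proposition 3.7, relation (12).) -/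
/-- The braid relation is invariant under simultaneous conjugation. -/
theorem braid_conj {G : Type*} [Group G] {a b : G} (c : G) (h : a * b * a = b * a * b) :
    (c * a * c⁻¹) * (c * b * c⁻¹) * (c * a * c⁻¹) =
      (c * b * c⁻¹) * (c * a * c⁻¹) * (c * b * c⁻¹) := by
  simpa using congrArg (MulAut.conj c) h

theorem inv_mul_mul_of_braid {G : Type*} [Group G] {a b : G} (h : a * b * a = b * a * b) :
    b⁻¹ * a * b = a * b * a⁻¹ := by
  rw [eq_mul_inv_iff_mul_eq, mul_assoc, mul_assoc, inv_mul_eq_iff_eq_mul, ← mul_assoc,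
    ← mul_assoc, h]

theorem mul_mul_inv_of_commute {G : Type*} [Group G] {a c : G} (h : a * c = c * a) :
    c * a * c⁻¹ = a := by
  rw [← h, mul_inv_cancel_right]

theorem inv_mul_mul_of_commute {G : Type*} [Group G] {a c : G} (h : a * c = c * a) :
    c⁻¹ * a * c = a := by
  rw [mul_assoc, h, inv_mul_cancel_left]


theorem stmt6 {G : Type*} [Group G]
    (g1 g2 g3 g4 g5 g6 g7 g8 g1' g2' g3' g4' g5' g6' g7' g8' : G)
    (h1 : g1 = g1')
    (h2_67 : ∀ a ∈ ({g6, g6'} : Set G), ∀ b ∈ ({g7, g7'} : Set G), a * b * a = b * a * b)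
    (h2_48 : ∀ a ∈ ({g4, g4'} : Set G), ∀ b ∈ ({g8, g8'} : Set G), a * b * a = b * a * b)
    (h2_12 : ∀ a ∈ ({g1, g1'} : Set G), ∀ b ∈ ({g2, g2'} : Set G), a * b * a = b * a * b)
    (h2_34 : ∀ a ∈ ({g3, g3'} : Set G), ∀ b ∈ ({g4, g4'} : Set G), a * b * a = b * a * b)
    (h2_56 : ∀ a ∈ ({g5, g5'} : Set G), ∀ b ∈ ({g6, g6'} : Set G), a * b * a = b * a * b)
    (h2_78 : ∀ a ∈ ({g7, g7'} : Set G), ∀ b ∈ ({g8, g8'} : Set G), a * b * a = b * a * b)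
    (h3_a : g7' = g6⁻¹ * g6'⁻¹ * g7 * g6' * g6)
    (h3_b : g4 = g8' * g8 * g4' * g8⁻¹ * g8'⁻¹)
    (h3_c : g1 = g2' * g2 * g1' * g2⁻¹ * g2'⁻¹)
    (h3_d : g4' = g3⁻¹ * g3'⁻¹ * g4 * g3' * g3)
    (h3_e : g5 = g6' * g6 * g5' * g6⁻¹ * g6'⁻¹)
    (h3_f : g7 = g8' * g8 * g7' * g8⁻¹ * g8'⁻¹)
    (h4_13 : ∀ a ∈ ({g1, g1'} : Set G), ∀ b ∈ ({g3, g3'} : Set G), a * b = b * a)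
    (h4_24 : ∀ a ∈ ({g2, g2'} : Set G), ∀ b ∈ ({g4, g4'} : Set G), a * b = b * a)
    (h4_14 : ∀ a ∈ ({g1, g1'} : Set G), ∀ b ∈ ({g4, g4'} : Set G), a * b = b * a)
    (h4_15 : ∀ a ∈ ({g1, g1'} : Set G), ∀ b ∈ ({g5, g5'} : Set G), a * b = b * a)
    (h4_45 : ∀ a ∈ ({g4, g4'} : Set G), ∀ b ∈ ({g5, g5'} : Set G), a * b = b * a)
    (h4_16 : ∀ a ∈ ({g1, g1'} : Set G), ∀ b ∈ ({g6, g6'} : Set G), a * b = b * a)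
    (h4_26 : ∀ a ∈ ({g2, g2'} : Set G), ∀ b ∈ ({g6, g6'} : Set G), a * b = b * a)
    (h4_36 : ∀ a ∈ ({g3, g3'} : Set G), ∀ b ∈ ({g6, g6'} : Set G), a * b = b * a)
    (h4_46 : ∀ a ∈ ({g4, g4'} : Set G), ∀ b ∈ ({g6, g6'} : Set G), a * b = b * a)
    (h4_17 : ∀ a ∈ ({g1, g1'} : Set G), ∀ b ∈ ({g7, g7'} : Set G), a * b = b * a)
    (h4_27 : ∀ a ∈ ({g2, g2'} : Set G), ∀ b ∈ ({g7, g7'} : Set G), a * b = b * a)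
    (h4_37 : ∀ a ∈ ({g3, g3'} : Set G), ∀ b ∈ ({g7, g7'} : Set G), a * b = b * a)
    (h4_47 : ∀ a ∈ ({g4, g4'} : Set G), ∀ b ∈ ({g7, g7'} : Set G), a * b = b * a)
    (h4_57 : ∀ a ∈ ({g5, g5'} : Set G), ∀ b ∈ ({g7, g7'} : Set G), a * b = b * a)
    (h4_18 : ∀ a ∈ ({g1, g1'} : Set G), ∀ b ∈ ({g8, g8'} : Set G), a * b = b * a)
    (h4_28 : ∀ a ∈ ({g2, g2'} : Set G), ∀ b ∈ ({g8, g8'} : Set G), a * b = b * a)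
    (h4_38 : ∀ a ∈ ({g3, g3'} : Set G), ∀ b ∈ ({g8, g8'} : Set G), a * b = b * a)
    (h4_58 : ∀ a ∈ ({g5, g5'} : Set G), ∀ b ∈ ({g8, g8'} : Set G), a * b = b * a)
    (h4_68 : ∀ a ∈ ({g6, g6'} : Set G), ∀ b ∈ ({g8, g8'} : Set G), a * b = b * a)
    (h5_a : ∀ a ∈ ({g2, g2'} : Set G), a * g3 * a = g3 * a * g3)
    (h5_b : ∀ b ∈ ({g5, g5'} : Set G), b * g3' * b = g3' * b * g3')
    (h5_c : g5' * g5 * g3' * g5⁻¹ * g5'⁻¹ = g3 * g2' * g2 * g3 * g2⁻¹ * g2'⁻¹ * g3⁻¹)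
    (h5_d : ∀ a ∈ ({g2, g2'} : Set G), ∀ b ∈ ({g5, g5'} : Set G),
      (g3 * a * g3⁻¹) * b = b * (g3 * a * g3⁻¹)) :
    (g3⁻¹ * g4 * g3) * (g5 * g6 * g7 * g8 * g4' * g8⁻¹ * g7⁻¹ * g6⁻¹ * g5⁻¹) * (g3⁻¹ * g4 * g3) =
      (g5 * g6 * g7 * g8 * g4' * g8⁻¹ * g7⁻¹ * g6⁻¹ * g5⁻¹) * (g3⁻¹ * g4 * g3) * (g5 * g6 * g7 * g8 * g4' * g8⁻¹ * g7⁻¹ * g6⁻¹ * g5⁻¹) := by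
  have b43 := h2_34 g3 (by simp) g4 (by simp)
  have b43' := h2_34 g3' (by simp) g4 (by simp)
  have b4'3 := h2_34 g3 (by simp) g4' (by simp)
  have h3_conj : g3 = (g4' * g4) * g3' * (g4' * g4)⁻¹ := by
    have e : g3 * g4' * g3⁻¹ = g3'⁻¹ * g4 * g3' := by rw [h3_d]; group
    rw [← inv_mul_mul_of_braid b4'3, inv_mul_mul_of_braid b43'.symm] at e
    calc g3 = g4' * (g4'⁻¹ * g3 * g4') * g4'⁻¹ := by group
      _ = _ := by rw [e]; group
  have h35 : g3 * g5 * g3 = g5 * g3 * g5 := by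
    have c5 : (g4' * g4) * g5 * (g4' * g4)⁻¹ = g5 := by
      apply mul_mul_inv_of_commute
      rw [← mul_assoc, ← h4_45 g4' (by simp) g5 (by simp), mul_assoc,
        ← h4_45 g4 (by simp) g5 (by simp), mul_assoc]
    have := braid_conj (g4' * g4) (h5_b g5 (by simp)).symm
    rwa [c5, ← h3_conj] at this
  have hu : g3⁻¹ * g4 * g3 = (g4 * g8'⁻¹ * g7⁻¹ * g6⁻¹) * g3 * (g4 * g8'⁻¹ * g7⁻¹ * g6⁻¹)⁻¹ := by
    calc g3⁻¹ * g4 * g3 = g4 * g3 * g4⁻¹ := inv_mul_mul_of_braid b43.symm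
      _ = g4 * (g8'⁻¹ * (g7⁻¹ * (g6⁻¹ * g3 * g6) * g7) * g8') * g4⁻¹ := by
        rw [inv_mul_mul_of_commute (h4_36 g3 (by simp) g6 (by simp)),
          inv_mul_mul_of_commute (h4_37 g3 (by simp) g7 (by simp)),
          inv_mul_mul_of_commute (h4_38 g3 (by simp) g8' (by simp))]
      _ = _ := by group
  have hv : g5 * g6 * g7 * g8 * g4' * g8⁻¹ * g7⁻¹ * g6⁻¹ * g5⁻¹ =
      (g4 * g8'⁻¹ * g7⁻¹ * g6⁻¹) * g5 * (g4 * g8'⁻¹ * g7⁻¹ * g6⁻¹)⁻¹ := by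
    have e : g8 * g4' * g8⁻¹ = g4 * g8' * g4⁻¹ := by
      rw [← inv_mul_mul_of_braid (h2_48 g4 (by simp) g8' (by simp)), h3_b]; group
    have c4567 : g4 * (g5 * g6 * g7) = (g5 * g6 * g7) * g4 := by
      rw [← mul_assoc, ← mul_assoc, h4_45 g4 (by simp) g5 (by simp), mul_assoc g5,
        h4_46 g4 (by simp) g6 (by simp), ← mul_assoc, mul_assoc _ g4,
        h4_47 g4 (by simp) g7 (by simp), ← mul_assoc]
    have c567 := mul_mul_inv_of_commute c4567
    have e8 : g5 * (g6 * (g7 * g8' * g7⁻¹) * g6⁻¹) * g5⁻¹ =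
        g8'⁻¹ * (g7⁻¹ * (g6⁻¹ * g5 * g6) * g7) * g8' := by
      rw [← inv_mul_mul_of_braid (h2_78 g7 (by simp) g8' (by simp)),
        inv_mul_mul_of_braid (h2_56 g5 (by simp) g6 (by simp))]
      calc g5 * (g6 * (g8'⁻¹ * g7 * g8') * g6⁻¹) * g5⁻¹
          = g5 * ((g6 * g8'⁻¹ * g6⁻¹) * (g6 * g7 * g6⁻¹) * (g6 * g8' * g6⁻¹)) * g5⁻¹ := by group
        _ = g5 * (g8'⁻¹ * (g7⁻¹ * g6 * g7) * g8') * g5⁻¹ := by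
          rw [← inv_mul_mul_of_braid (h2_67 g6 (by simp) g7 (by simp)),
            ← conj_inv, mul_mul_inv_of_commute (h4_68 g6 (by simp) g8' (by simp)).symm]
        _ = (g5 * g8' * g5⁻¹)⁻¹ * ((g5 * g7 * g5⁻¹)⁻¹ * (g5 * g6 * g5⁻¹) * (g5 * g7 * g5⁻¹)) *
            (g5 * g8' * g5⁻¹) := by group
        _ = _ := by
          rw [mul_mul_inv_of_commute (h4_58 g5 (by simp) g8' (by simp)).symm,
            mul_mul_inv_of_commute (h4_57 g5 (by simp) g7 (by simp)).symm]
    calc g5 * g6 * g7 * g8 * g4' * g8⁻¹ * g7⁻¹ * g6⁻¹ * g5⁻¹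
        = (g5 * g6 * g7) * (g8 * g4' * g8⁻¹) * (g5 * g6 * g7)⁻¹ := by group
      _ = ((g5 * g6 * g7) * g4 * (g5 * g6 * g7)⁻¹) *
          (g5 * (g6 * (g7 * g8' * g7⁻¹) * g6⁻¹) * g5⁻¹) *
          ((g5 * g6 * g7) * g4 * (g5 * g6 * g7)⁻¹)⁻¹ := by rw [e]; group
      _ = _ := by rw [c567, e8]; group
  rw [hu, hv]
  exact braid_conj _ h35
end

section
/- Let G be a group and x₁,…,x₈, x₄' ∈ G elements such that x₄ = x₄', each xᵢ and x₄' is an involution (xᵢ² = e, x₄'² = e), and the braid relations x₁x₂x₁ = x₂x₁x₂, x₃x₄x₃ = x₄x₃x₄, and x₄x₈x₄ = x₈x₄x₈ hold. Then, writing a_b := b⁻¹ab, the relation ρ₁ holds automatically (it 'becomes trivial'): (x₄')_{x₃⁻¹x₄x₅⁻¹x₆⁻¹x₇⁻¹x₈⁻¹x₄⁻¹x₈x₄'⁻¹x₈⁻¹x₄x₇⁻¹x₆⁻¹x₅⁻¹} = (x₃)_{x₂⁻¹x₁⁻¹x₂x₁⁻¹x₂⁻¹x₁x₃⁻¹}.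 (Key step in the proof of the theorem computing π₁((S_g)_Gal): in the quotient of G₁ by the relations Γ² = 1 and Γ₄ = Γ₄', the extra relation ρ₁ becomes trivial.) -/
/-- In a group, two involutions satisfying the braid relation satisfy `a * (b * (a * (b * a))) = b`. -/
theorem mul_mul_mul_mul_eq_of_braid {G : Type*} [Group G] {a b : G}
    (ha : a * a = 1) (hb : b * b = 1) (h : a * b * a = b * a * b) :
    a * (b * (a * (b * a))) = b := by
  calc a * (b * (a * (b * a))) = (a * b * a) * (b * a) := by group
    _ = b * a * (b * b) * a := by rw [h]; group
    _ = b * (a * a) := by rw [hb]; group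
    _ = b := by rw [ha, mul_one]


theorem stmt8 {G : Type*} [Group G]
    (x1 x2 x3 x4 x5 x6 x7 x8 x4' : G)
    (h44' : x4 = x4')
    (hinv1 : x1 ^ 2 = 1) (hinv2 : x2 ^ 2 = 1) (hinv3 : x3 ^ 2 = 1) (hinv4 : x4 ^ 2 = 1)
    (hinv5 : x5 ^ 2 = 1) (hinv6 : x6 ^ 2 = 1) (hinv7 : x7 ^ 2 = 1) (hinv8 : x8 ^ 2 = 1)
    (hinv4' : x4' ^ 2 = 1)
    (hb12 : x1 * x2 * x1 = x2 * x1 * x2)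
    (hb34 : x3 * x4 * x3 = x4 * x3 * x4)
    (hb48 : x4 * x8 * x4 = x8 * x4 * x8) :
    (x3⁻¹ * x4 * x5⁻¹ * x6⁻¹ * x7⁻¹ * x8⁻¹ * x4⁻¹ * x8 * x4'⁻¹ * x8⁻¹ * x4 * x7⁻¹ * x6⁻¹ * x5⁻¹)⁻¹ * x4' * (x3⁻¹ * x4 * x5⁻¹ * x6⁻¹ * x7⁻¹ * x8⁻¹ * x4⁻¹ * x8 * x4'⁻¹ * x8⁻¹ * x4 * x7⁻¹ * x6⁻¹ * x5⁻¹) =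
      (x2⁻¹ * x1⁻¹ * x2 * x1⁻¹ * x2⁻¹ * x1 * x3⁻¹)⁻¹ * x3 * (x2⁻¹ * x1⁻¹ * x2 * x1⁻¹ * x2⁻¹ * x1 * x3⁻¹) := by
  subst h44'
  rw [pow_two] at hinv1 hinv2 hinv3 hinv4 hinv5 hinv6 hinv7 hinv8
  have cancel {a : G} (ha : a * a = 1) (y : G) : a * (a * y) = y := by
    rw [← mul_assoc, ha, one_mul]
  have h84 := mul_mul_mul_mul_eq_of_braid hinv8 hinv4 hb48.symm
  have h43 := mul_mul_mul_mul_eq_of_braid hinv4 hinv3 hb34.symm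
  have h21 := mul_mul_mul_mul_eq_of_braid hinv2 hinv1 hb12.symm
  have left_word : x3⁻¹ * x4 * x5⁻¹ * x6⁻¹ * x7⁻¹ * x8⁻¹ * x4⁻¹ * x8 * x4⁻¹ * x8⁻¹ * x4 *
      x7⁻¹ * x6⁻¹ * x5⁻¹ = x3 * x4 := by
    rw [inv_eq_of_mul_eq_one_left hinv3, inv_eq_of_mul_eq_one_left hinv5, inv_eq_of_mul_eq_one_left hinv6,
      inv_eq_of_mul_eq_one_left hinv7, inv_eq_of_mul_eq_one_left hinv8, inv_eq_of_mul_eq_one_left hinv4]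
    calc _ = x3 * x4 * x5 * x6 * x7 * (x8 * (x4 * (x8 * (x4 * x8)))) * x4 * x7 * x6 * x5 := by
          simp only [mul_assoc]
      _ = x3 * x4 := by
          rw [h84]
          simp only [mul_assoc, cancel hinv4, cancel hinv7, cancel hinv6, hinv5, mul_one]
  have right_word : x2⁻¹ * x1⁻¹ * x2 * x1⁻¹ * x2⁻¹ * x1 * x3⁻¹ = x3 := by
    rw [inv_eq_of_mul_eq_one_left hinv1, inv_eq_of_mul_eq_one_left hinv2, inv_eq_of_mul_eq_one_left hinv3]
    calc _ = (x2 * (x1 * (x2 * (x1 * x2)))) * x1 * x3 := by simp only [mul_assoc]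
      _ = x3 := by rw [h21, hinv1, one_mul]
  rw [left_word, right_word, mul_inv_rev, inv_eq_of_mul_eq_one_left hinv3,
    inv_eq_of_mul_eq_one_left hinv4]
  simpa only [mul_assoc, hinv3, one_mul, mul_one] using h43
end

section
/- Let G be a group and t, t', f, f', u ∈ G satisfying: t'ut' = ut'u (braid relation between t' and u), f' = t⁻¹t'⁻¹ft't, t'ft' = ft'f (braid relation between t' and f), tf't = f'tf' (braid relation between t and f'), fu = uf, and f'u = uf'. Then the braid relation tut = utu holds. (General form of the first chain in the proof of Proposition 3.3, relation (6), with t = Γ₃, t' = Γ₃', f = Γ₄, f' = Γ₄', u ∈ {Γ₅, Γ₅'}: from ⟨3',5̲⟩ = e one deduces ⟨3,5̲⟩ = e.) -/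
/-- A braid relation transfers along conjugation by an element commuting with one of its terms. -/
theorem braid_of_semiconjBy {G : Type*} [Group G] {a x y u : G}
    (hxy : SemiconjBy a x y) (hu : Commute a u) (h : x * u * x = u * x * u) :
    y * u * y = u * y * u := by
  have h₁ : SemiconjBy a (x * u * x) (y * u * y) := (hxy.mul_right hu).mul_right hxy
  have h₂ : SemiconjBy a (u * x * u) (u * y * u) := (SemiconjBy.mul_right hu hxy).mul_right hu
  rw [h] at h₁
  exact mul_right_cancel (h₁.eq.symm.trans h₂.eq)

theorem stmt11 {G : Type*} [Group G] (t t' f f' u : G)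
    (h1 : t' * u * t' = u * t' * u)
    (h2 : f' = t⁻¹ * t'⁻¹ * f * t' * t)
    (h3 : t' * f * t' = f * t' * f)
    (h4 : t * f' * t = f' * t * f')
    (h5 : f * u = u * f)
    (h6 : f' * u = u * f') :
    t * u * t = u * t * u := by
  have hf : f * t' * f⁻¹ = t'⁻¹ * f * t' := by
    rw [mul_inv_eq_iff_eq_mul, mul_assoc, mul_assoc, eq_inv_mul_iff_mul_eq, ← mul_assoc, h3,
      mul_assoc]
  have hf' : t * f' * t⁻¹ = f'⁻¹ * t * f' := by
    rw [mul_inv_eq_iff_eq_mul, mul_assoc f'⁻¹, mul_assoc f'⁻¹, eq_inv_mul_iff_mul_eq,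
      ← mul_assoc, ← h4]
  have hconj : t * f' * t⁻¹ = t'⁻¹ * f * t' := by
    rw [h2]; group
  have hs : SemiconjBy (f' * f) t' t := by
    have h : f * t' * f⁻¹ = f'⁻¹ * t * f' := by rw [hf, ← hconj, hf']
    calc f' * f * t' = f' * (f * t' * f⁻¹) * f := by group
      _ = t * (f' * f) := by rw [h]; group
  exact braid_of_semiconjBy hs (Commute.mul_left h6 h5) h1
end

section
/- Let G be a group and d, t, t', f, f' ∈ G satisfying: dtd = tdt (braid relation between d and t), f' = t⁻¹t'⁻¹ft't, tf't = f'tf' (braid relation between t and f'), t'ft' = ft'f (braid relation between t' and f), df = fd, and df' = f'd. Then the braid relation dt'd = t'dt' holds. (General form of the second chain in the proof of Proposition 3.3, relation (6), with d ∈ {Γ₂, Γ₂'}, t = Γ₃, t' = Γ₃', f = Γ₄, f' = Γ₄': from ⟨2̲,3⟩ = e one deduces ⟨2̲,3'⟩ = e.) -/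
theorem stmt12 {G : Type*} [Group G] (d t t' f f' : G)
    (h1 : d * t * d = t * d * t)
    (h2 : f' = t⁻¹ * t'⁻¹ * f * t' * t)
    (h3 : t * f' * t = f' * t * f')
    (h4 : t' * f * t' = f * t' * f)
    (h5 : d * f = f * d)
    (h6 : d * f' = f' * d) :
    d * t' * d = t' * d * t' := by
  have hconj : f' * f * t' = t * (f' * f) := by
    have hleft : t * f' * t⁻¹ = f'⁻¹ * t * f' := by
      rw [mul_inv_eq_iff_eq_mul, mul_assoc f'⁻¹, mul_assoc f'⁻¹, eq_inv_mul_iff_mul_eq]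
      simpa only [mul_assoc] using h3.symm
    have hright : t'⁻¹ * f * t' = f * t' * f⁻¹ := by
      rw [eq_mul_inv_iff_mul_eq, mul_assoc, mul_assoc, inv_mul_eq_iff_eq_mul]
      simpa only [mul_assoc] using h4.symm
    have hmid : t * f' * t⁻¹ = t'⁻¹ * f * t' := by
      rw [h2]; group
    calc f' * f * t' = f' * (f * t' * f⁻¹) * f := by group
      _ = f' * (f'⁻¹ * t * f') * f := by rw [← hright, ← hmid, hleft]
      _ = t * (f' * f) := by group
  have hd : Commute d (f' * f) := Commute.mul_right h6 h5
  obtain rfl : t' = MulAut.conj (f' * f)⁻¹ t := by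
    rw [MulAut.conj_apply, inv_inv, mul_assoc, ← hconj, inv_mul_cancel_left]
  have hfix : MulAut.conj (f' * f)⁻¹ d = d := by
    rw [MulAut.conj_apply, inv_inv, mul_assoc, hd.eq, inv_mul_cancel_left]
  simpa only [map_mul, hfix] using congrArg (MulAut.conj (f' * f)⁻¹) h1
end
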